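/- arXiv:2510.00772 — 3 statements merged into one kernel-verified Lean document; each statement's English description precedes it below -/
import Mathlib

section
/- Let X ⊆ ℕ with 0 ∈ X and suppose the lower asymptotic density of 2X is strictly less than twice the lower asymptotic density of X. Then nX = (n+1)X for all sufficiently large n. -/
open Pointwise

/-- `nsum X n` is the `n`-fold sumset of `X ⊆ ℕ`, with `nsum X 0 = {0}`. -/
def nsum (X : Set ℕ) : ℕ → Set ℕ
  | 0 => {0}
  | n + 1 => nsum X n + X

/-- The lower asymptotic density of a set of naturals. -/
noncomputable def ldens (X : Set ℕ) : ℝ :=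
  Filter.atTop.liminf fun n : ℕ => ((X ∩ Set.Icc 1 n).ncard : ℝ) / n

theorem nsum_zero_mem {X : Set ℕ} (h0 : 0 ∈ X) (n : ℕ) : 0 ∈ nsum X n := by
  induction n with
  | zero => simp [nsum]
  | succ n ih => exact Set.mem_add.2 ⟨0, ih, 0, h0, rfl⟩

theorem nsum_add {X : Set ℕ} {a b x y : ℕ} (hx : x ∈ nsum X a) (hy : y ∈ nsum X b) :
    x + y ∈ nsum X (a + b) := by
  induction b generalizing y with
  | zero =>
    have : y = 0 := by simpa [nsum] using hy
    subst this; simpa using hx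
  | succ b ih =>
    obtain ⟨u, hu, v, hv, rfl⟩ := Set.mem_add.1 hy
    exact Set.mem_add.2 ⟨x + u, ih hu, v, hv, by ring⟩

theorem nsum_mono {X : Set ℕ} (h0 : 0 ∈ X) {a b x : ℕ} (hab : a ≤ b) (hx : x ∈ nsum X a) :
    x ∈ nsum X b := by
  obtain ⟨c, rfl⟩ := Nat.exists_eq_add_of_le hab
  simpa using nsum_add hx (nsum_zero_mem h0 c)

theorem nsum_mul {X : Set ℕ} {a x : ℕ} (hx : x ∈ nsum X a) (q : ℕ) :
    q * x ∈ nsum X (q * a) := by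
  induction q with
  | zero => simp [nsum]
  | succ q ih =>
    have := nsum_add ih hx
    rwa [← Nat.succ_mul, ← Nat.succ_mul] at this

theorem nsum_affine {X : Set ℕ} {m d a : ℕ} {y k : ℕ}
    (hy : y ∈ nsum {y | m + d * y ∈ nsum X a} k) : k * m + d * y ∈ nsum X (k * a) := by
  induction k generalizing y with
  | zero =>
    have : y = 0 := by simpa [nsum] using hy
    subst this; simp [nsum]
  | succ k ih =>
    obtain ⟨u, hu, v, hv, rfl⟩ := Set.mem_add.1 hy
    have := nsum_add (ih hu) hv
    rw [← Nat.succ_mul] at this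
    convert this using 1
    ring

open Classical in
/-- counting function -/
noncomputable def cnt (A : Set ℕ) (n : ℕ) : ℕ := ((Finset.Icc 1 n).filter (· ∈ A)).card

theorem cnt_eq (A : Set ℕ) (n : ℕ) : (A ∩ Set.Icc 1 n).ncard = cnt A n := by
  classical
  unfold cnt
  rw [← Set.ncard_coe_finset]
  congr 1
  ext x
  simp only [Set.mem_inter_iff, Set.mem_Icc, Finset.coe_filter, Finset.mem_Icc, Set.mem_setOf_eq]
  tauto

theorem cnt_succ_mem {A : Set ℕ} {n : ℕ} (h : n + 1 ∈ A) : cnt A (n + 1) = cnt A n + 1 := by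
  classical
  unfold cnt
  rw [← Finset.insert_Icc_right_eq_Icc_add_one (by omega), Finset.filter_insert, if_pos h,
    Finset.card_insert_of_notMem (by simp)]

theorem cnt_succ_not {A : Set ℕ} {n : ℕ} (h : n + 1 ∉ A) : cnt A (n + 1) = cnt A n := by
  classical
  unfold cnt
  rw [← Finset.insert_Icc_right_eq_Icc_add_one (by omega), Finset.filter_insert, if_neg h]

theorem cnt_le (A : Set ℕ) (n : ℕ) : cnt A n ≤ n := by
  classical
  unfold cnt
  exact (Finset.card_filter_le _ _).trans (by simp)

theorem cnt_shift {A B : Set ℕ} {a : ℕ} (ha : a ∈ A) (t : ℕ) :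
    cnt (A + B) a + cnt B t ≤ cnt (A + B) (a + t) := by
  induction t with
  | zero => simp [cnt]
  | succ t ih =>
    rw [← Nat.add_assoc]
    by_cases h : t + 1 ∈ B
    · rw [cnt_succ_mem h, cnt_succ_mem (Set.mem_add.2 ⟨a, ha, t + 1, h, by ring⟩)]
      omega
    · rw [cnt_succ_not h]
      by_cases h' : a + t + 1 ∈ A + B
      · rw [cnt_succ_mem h']; omega
      · rw [cnt_succ_not h']; omega

theorem exists_last {A : Set ℕ} (hA : 0 ∈ A) (n : ℕ) :
    ∃ a t, a + t = n ∧ a ∈ A ∧ cnt A n = cnt A a := by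
  induction n with
  | zero => exact ⟨0, 0, rfl, hA, rfl⟩
  | succ n ih =>
    by_cases h : n + 1 ∈ A
    · exact ⟨n + 1, 0, rfl, h, rfl⟩
    · obtain ⟨a, t, h1, h2, h3⟩ := ih
      exact ⟨a, t + 1, by omega, h2, by rw [cnt_succ_not h, h3]⟩

theorem schnir {A B : Set ℕ} (hA : 0 ∈ A) (hB : 0 ∈ B) {β : ℝ}
    (hβ : ∀ n, β * n ≤ cnt B n) (n : ℕ) :
    (cnt A n : ℝ) + β * (n - cnt A n) ≤ cnt (A + B) n := by
  induction n using Nat.strong_induction_on with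
  | _ n ih =>
  obtain ⟨a, t, h1, h2, h3⟩ := exists_last hA n
  rcases Nat.eq_zero_or_pos t with rfl | ht
  · rcases n with _ | n
    · simp [cnt]
    · have ha : n + 1 ∈ A := by rw [← h1]; simpa using h2
      have := ih n (by omega)
      rw [cnt_succ_mem ha, cnt_succ_mem (Set.mem_add.2 ⟨n + 1, ha, 0, hB, by ring⟩)]
      push_cast
      linarith
  · have := ih a (by omega)
    have h4 := hβ t
    have h5 : ((cnt (A + B) a + cnt B t : ℕ) : ℝ) ≤ cnt (A + B) (a + t) := by
      exact_mod_cast cnt_shift h2 t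
    rw [h3]
    rw [← h1]
    push_cast at h5 ⊢
    linarith

theorem cnt_nsum {Y : Set ℕ} (h0 : 0 ∈ Y) {β : ℝ} (hβ1 : β ≤ 1)
    (hβ : ∀ n, β * n ≤ cnt Y n) (k n : ℕ) :
    (1 - (1 - β) ^ k) * n ≤ cnt (nsum Y k) n := by
  induction k with
  | zero => simp
  | succ k ih =>
    have := schnir (nsum_zero_mem h0 k) h0 hβ n
    change _ ≤ (cnt (nsum Y k + Y) n : ℝ)
    refine le_trans ?_ this
    have := mul_le_mul_of_nonneg_left ih (sub_nonneg.2 hβ1)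
    rw [pow_succ]
    linarith

theorem pigeon {A : Set ℕ} (h0 : 0 ∈ A) {n : ℕ} (h : n < 2 * cnt A n) : n ∈ A + A := by
  classical
  by_contra hn
  have hnA : n ∉ A := fun h => hn (Set.mem_add.2 ⟨0, h0, n, h, by ring⟩)
  set F := (Finset.Icc 1 n).filter (· ∈ A) with hF
  have hFc : F.card = cnt A n := rfl
  have hlt : ∀ x ∈ F, 1 ≤ x ∧ x < n ∧ x ∈ A := by
    intro x hx
    simp only [hF, Finset.mem_filter, Finset.mem_Icc] at hx
    refine ⟨hx.1.1, lt_of_le_of_ne hx.1.2 ?_, hx.2⟩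
    rintro rfl; exact hnA hx.2
  have hc : (F.image (fun x => n - x)).card = F.card := by
    apply Finset.card_image_of_injOn
    intro x hx y hy hxy
    have := hlt x hx
    have := hlt y hy
    simp only at hxy
    omega
  have hd : Disjoint F (F.image (fun x => n - x)) := by
    rw [Finset.disjoint_left]
    intro x hx hx'
    obtain ⟨y, hy, rfl⟩ := Finset.mem_image.1 hx'
    have h1 := hlt _ hx
    have h2 := hlt _ hy
    exact hn (Set.mem_add.2 ⟨n - y, h1.2.2, y, h2.2.2, by omega⟩)
  have hs : F ∪ F.image (fun x => n - x) ⊆ Finset.Icc 1 n := by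
    intro x hx
    rw [Finset.mem_union, Finset.mem_image] at hx
    rw [Finset.mem_Icc]
    rcases hx with hx | ⟨y, hy, rfl⟩
    · have := hlt _ hx; omega
    · have := hlt _ hy; omega
  have := Finset.card_le_card hs
  rw [Finset.card_union_of_disjoint hd, hc, Nat.card_Icc] at this
  omega

theorem basis {Y : Set ℕ} (h0 : 0 ∈ Y) {β : ℝ} (hβ0 : 0 < β)
    (hβ : ∀ n, β * n ≤ cnt Y n) : ∃ k, ∀ n, n ∈ nsum Y k := by
  have hβ1 : β ≤ 1 := by
    have h1 := hβ 1
    have h2 : (cnt Y 1 : ℝ) ≤ 1 := by exact_mod_cast cnt_le Y 1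
    push_cast at h1
    linarith
  obtain ⟨k, hk⟩ := exists_pow_lt_of_lt_one (show (0 : ℝ) < 1 / 2 by norm_num)
    (show 1 - β < 1 by linarith)
  refine ⟨k + k, fun n => ?_⟩
  rcases Nat.eq_zero_or_pos n with rfl | hn
  · exact nsum_zero_mem h0 _
  have h1 := cnt_nsum h0 hβ1 hβ k n
  have hn' : (0 : ℝ) < n := by exact_mod_cast hn
  have h2 : (n : ℝ) < 2 * cnt (nsum Y k) n := by nlinarith
  have h3 : n < 2 * cnt (nsum Y k) n := by exact_mod_cast h2
  obtain ⟨x, hx, y, hy, rfl⟩ := Set.mem_add.1 (pigeon (nsum_zero_mem h0 k) h3)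
  exact nsum_add hx hy

theorem dens_pos {X : Set ℕ} (h : 0 < ldens X) :
    ∃ c : ℝ, 0 < c ∧ ∃ N, ∀ n ≥ N, c * n ≤ cnt X n := by
  refine ⟨ldens X / 2, by linarith, ?_⟩
  have hlt : ldens X / 2 < Filter.atTop.liminf
      (fun n : ℕ => ((X ∩ Set.Icc 1 n).ncard : ℝ) / n) := by
    change _ < ldens X
    linarith
  have hb : Filter.IsBoundedUnder (· ≥ ·) Filter.atTop
      (fun n : ℕ => ((X ∩ Set.Icc 1 n).ncard : ℝ) / n) :=
    Filter.isBoundedUnder_of ⟨0, fun n => by positivity⟩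
  have := Filter.eventually_lt_of_lt_liminf hlt hb
  obtain ⟨N, hN⟩ := Filter.eventually_atTop.1 this
  refine ⟨N, fun n hn => ?_⟩
  have h1 := hN n hn
  rw [cnt_eq] at h1
  rcases Nat.eq_zero_or_pos n with rfl | hn
  · simp
  have hn' : (0 : ℝ) < n := by exact_mod_cast hn
  rw [lt_div_iff₀ hn'] at h1
  exact h1.le

theorem dens_nonneg (X : Set ℕ) : 0 ≤ ldens X := by
  unfold ldens
  have hle : ∀ n : ℕ, ((X ∩ Set.Icc 1 n).ncard : ℝ) / n ≤ 1 := by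
    intro n
    rw [cnt_eq]
    apply div_le_one_of_le₀ _ (by positivity)
    exact_mod_cast cnt_le X n
  apply Filter.le_liminf_of_le
  · exact (Filter.isBoundedUnder_of ⟨1, hle⟩).isCoboundedUnder_ge
  · exact Filter.Eventually.of_forall fun n => by positivity

/-- Elements of `X` in `(m, m + d N]`, all congruent to `m` mod `d`, give elements of `Y`. -/
theorem cnt_affine {X Y : Set ℕ} {m d : ℕ} (hd : 0 < d) (hm : d ∣ m) (hX : ∀ x ∈ X, d ∣ x)
    (hY : ∀ y, m + d * y ∈ X → y ∈ Y) (N : ℕ) : cnt X (m + d * N) ≤ m + cnt Y N := by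
  classical
  have hs : (Finset.Icc 1 (m + d * N)).filter (· ∈ X) ⊆
      Finset.Icc 1 m ∪ ((Finset.Icc 1 N).filter (· ∈ Y)).image (fun y => m + d * y) := by
    intro x hx
    simp only [Finset.mem_filter, Finset.mem_Icc] at hx
    rw [Finset.mem_union]
    by_cases h : x ≤ m
    · left; rw [Finset.mem_Icc]; omega
    · right
      obtain ⟨y, hy⟩ : d ∣ x - m := Nat.dvd_sub (hX x hx.2) hm
      have hxy : x = m + d * y := by omega
      subst hxy
      refine Finset.mem_image.2 ⟨y, ?_, rfl⟩
      simp only [Finset.mem_filter, Finset.mem_Icc]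
      refine ⟨⟨?_, ?_⟩, hY y hx.2⟩
      · by_contra h0
        have : y = 0 := by omega
        subst this; simp at h
      · exact Nat.le_of_mul_le_mul_left (by omega : d * y ≤ d * N) hd
  unfold cnt
  refine (Finset.card_le_card hs).trans ((Finset.card_union_le _ _).trans ?_)
  have := Finset.card_image_le (s := (Finset.Icc 1 N).filter (· ∈ Y)) (f := fun y => m + d * y)
  simp only [Nat.card_Icc, Nat.add_sub_cancel]
  omega

theorem main_aux (X : Set ℕ) (h0 : (0 : ℕ) ∈ X) (hpos : 0 < ldens X) :
    ∃ N : ℕ, ∀ n ≥ N, nsum X n = nsum X (n + 1) := by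
  classical
  obtain ⟨c, hc, M, hM⟩ := dens_pos hpos
  -- a positive element
  have hex : ∃ d, 0 < d ∧ ∃ m a, m ∈ nsum X a ∧ m + d ∈ nsum X a := by
    have h1 := hM (M + 1) (by omega)
    have h2 : (0 : ℝ) < cnt X (M + 1) := lt_of_lt_of_le (by positivity) h1
    have h3 : 0 < cnt X (M + 1) := by exact_mod_cast h2
    obtain ⟨x, hx⟩ := Finset.card_pos.1 h3
    simp only [Finset.mem_filter, Finset.mem_Icc] at hx
    exact ⟨x, by omega, 0, 1, nsum_zero_mem h0 1,
      Set.mem_add.2 ⟨0, by simp [nsum], x, hx.2, rfl⟩⟩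
  obtain ⟨hd, m, a, hma, hmda⟩ := Nat.find_spec hex
  have hmin := fun e (he : e < Nat.find hex) => Nat.find_min hex he
  generalize Nat.find hex = d at *
  have hdvd : ∀ n x, x ∈ nsum X n → d ∣ x := by
    intro n x hx
    by_contra hnd
    have hr : 0 < x % d := Nat.pos_of_ne_zero fun h => hnd (Nat.dvd_of_mod_eq_zero h)
    refine hmin (x % d) (Nat.mod_lt _ hd) ⟨hr, x / d * (m + d), x / d * a + n, ?_, ?_⟩
    · exact nsum_mono h0 (by omega) (nsum_mul hmda _)
    · have := nsum_add (nsum_mul hma (x / d)) hx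
      have h4 := Nat.div_add_mod x d
      have h5 : x / d * (m + d) + x % d = x / d * m + x := by
        rw [Nat.mul_add, Nat.mul_comm (x / d) d]
        omega
      rwa [h5]
  have hX1 : ∀ x ∈ X, x ∈ nsum X 1 := fun x hx =>
    Set.mem_add.2 ⟨0, by simp [nsum], x, hx, by simp⟩
  set Y : Set ℕ := {y | m + d * y ∈ nsum X (a + 1)} with hYdef
  have hY0 : 0 ∈ Y := by
    show m + d * 0 ∈ nsum X (a + 1)
    exact nsum_mono h0 (Nat.le_succ a) (by simpa using hma)
  have hY1 : 1 ∈ Y := by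
    show m + d * 1 ∈ nsum X (a + 1)
    exact nsum_mono h0 (Nat.le_succ a) (by simpa using hmda)
  have hcnt := cnt_affine (X := X) (Y := Y) hd (hdvd _ _ hma) (fun x hx => hdvd 1 x (hX1 x hx))
    (fun y hy => nsum_mono h0 (by omega) (hX1 _ hy))
  have hone : ∀ n, 1 ≤ n → 1 ≤ cnt Y n := by
    intro n hn
    apply Finset.card_pos.2
    exact ⟨1, by simp [hY1, hn]⟩
  -- a uniform lower bound
  obtain ⟨K, hK⟩ := exists_nat_gt (2 * m / c + M + 1)
  have hdR : (1 : ℝ) ≤ d := by exact_mod_cast hd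
  have hKpos : (0 : ℝ) < K := lt_of_le_of_lt (by positivity) hK
  have hbound : ∀ n, min (c / 2) (1 / K) * n ≤ cnt Y n := by
    intro n
    rcases Nat.eq_zero_or_pos n with rfl | hn
    · simp
    have hn' : (0 : ℝ) < n := by exact_mod_cast hn
    by_cases hnK : n ≤ K
    · have h1 : (1 : ℝ) ≤ cnt Y n := by exact_mod_cast hone n hn
      have h2 : (n : ℝ) ≤ K := by exact_mod_cast hnK
      calc min (c / 2) (1 / (K : ℝ)) * n ≤ 1 / K * n := by gcongr; exact min_le_right _ _
        _ ≤ 1 := by rw [one_div, inv_mul_le_iff₀ hKpos]; linarith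
        _ ≤ _ := h1
    · have h2 : (K : ℝ) < n := by exact_mod_cast not_le.1 hnK
      have hdiv : 0 ≤ 2 * m / c := by positivity
      have hMn : (M : ℝ) ≤ n := by linarith
      have hMn' : M ≤ n := by exact_mod_cast hMn
      have h3 := hM (m + d * n) (by nlinarith)
      have h4 : (cnt X (m + d * n) : ℝ) ≤ m + cnt Y n := by exact_mod_cast hcnt n
      have h5 : 2 * m / c ≤ n := by
        have : (0 : ℝ) ≤ M := by positivity
        linarith
      rw [div_le_iff₀ hc] at h5
      push_cast at h3
      have h6 : c * n ≤ c * (m + d * n) := by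
        apply mul_le_mul_of_nonneg_left _ hc.le
        have : (0 : ℝ) ≤ m := by positivity
        nlinarith
      calc min (c / 2) (1 / (K : ℝ)) * n ≤ c / 2 * n := by gcongr; exact min_le_left _ _
        _ ≤ _ := by linarith
  obtain ⟨k, hk⟩ := basis hY0 (lt_min (by positivity) (by positivity)) hbound
  have hbig : ∀ x, d ∣ x → k * m ≤ x → x ∈ nsum X (k * (a + 1)) := by
    intro x hx hle
    obtain ⟨y, hy⟩ : d ∣ x - k * m := Nat.dvd_sub hx ((hdvd _ _ hma).mul_left k)
    have h := nsum_affine (hk y)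
    have : k * m + d * y = x := by omega
    rwa [this] at h
  -- the remaining elements
  have hsmall : ∀ x, ∃ n, (∃ n', x ∈ nsum X n') → x ∈ nsum X n := by
    intro x
    by_cases h : ∃ n', x ∈ nsum X n'
    · exact ⟨h.choose, fun _ => h.choose_spec⟩
    · exact ⟨0, fun h' => absurd h' h⟩
  choose f hf using hsmall
  refine ⟨k * (a + 1) + (Finset.range (k * m)).sup f, fun n hn => ?_⟩
  ext x
  refine ⟨nsum_mono h0 (by omega), fun hx => ?_⟩
  by_cases hle : k * m ≤ x
  · exact nsum_mono h0 (by omega) (hbig x (hdvd _ _ hx) hle)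
  · have : f x ≤ (Finset.range (k * m)).sup f :=
      Finset.le_sup (Finset.mem_range.2 (by omega))
    exact nsum_mono h0 (by omega) (hf x ⟨_, hx⟩)

theorem stmt_12 (X : Set ℕ) (h0 : (0 : ℕ) ∈ X)
    (hd : ldens (nsum X 2) < 2 * ldens X) :
    ∃ N : ℕ, ∀ n ≥ N, nsum X n = nsum X (n + 1) := by
  have := dens_nonneg (nsum X 2)
  exact main_aux X h0 (by linarith)
end

section
/- If H is a numerical monoid and K is a commutative monoid with P(H) ≅ P(K), then x² ≠ xy for all distinct x, y ∈ K; moreover K is cancellative. -/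
open Pointwise

noncomputable instance powAdd {M : Type*} [Add M] : Add {X : Set M // X.Nonempty} :=
  ⟨fun A B => ⟨A.1 + B.1, A.2.add B.2⟩⟩

noncomputable instance powMul {M : Type*} [Mul M] : Mul {X : Set M // X.Nonempty} :=
  ⟨fun A B => ⟨A.1 * B.1, A.2.mul B.2⟩⟩

/-- Order embedding with downward closed range. -/
def LowEmb {α β : Type*} [PartialOrder α] [PartialOrder β] (φ : α → β) : Prop :=
  (∀ a b, φ a ≤ φ b ↔ a ≤ b) ∧ ∀ a e, e ≤ φ a → ∃ n, φ n = e

/-- There is a greatest element strictly below `a`. -/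
def LocalAt {α : Type*} [PartialOrder α] (a : α) : Prop := ∃ r, r < a ∧ ∀ n, n < a → n ≤ r

theorem LowEmb.comp {α β γ : Type*} [PartialOrder α] [PartialOrder β] [PartialOrder γ]
    {φ : α → β} {ψ : β → γ} (h : LowEmb φ) (k : LowEmb ψ) : LowEmb (fun a => ψ (φ a)) := by
  refine ⟨fun a b => (k.1 _ _).trans (h.1 _ _), fun a e he => ?_⟩
  obtain ⟨n, rfl⟩ := k.2 _ _ he
  obtain ⟨m, rfl⟩ := h.2 _ _ ((k.1 _ _).1 he)
  exact ⟨m, rfl⟩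

theorem LowEmb.lt {α β : Type*} [PartialOrder α] [PartialOrder β] {φ : α → β}
    (h : LowEmb φ) (a b : α) : φ a < φ b ↔ a < b := by
  rw [lt_iff_le_not_ge, lt_iff_le_not_ge, h.1, h.1]

theorem LowEmb.inj {α β : Type*} [PartialOrder α] [PartialOrder β] {φ : α → β}
    (h : LowEmb φ) {a b : α} (e : φ a = φ b) : a = b :=
  le_antisymm ((h.1 _ _).1 e.le) ((h.1 _ _).1 e.ge)

theorem LowEmb.local_iff {α β : Type*} [PartialOrder α] [PartialOrder β] {φ : α → β}
    (h : LowEmb φ) (a : α) : LocalAt (φ a) ↔ LocalAt a := by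
  constructor
  · rintro ⟨r, hr, hm⟩
    obtain ⟨s, rfl⟩ := h.2 a r hr.le
    exact ⟨s, (h.lt _ _).1 hr, fun n hn => (h.1 _ _).1 (hm _ ((h.lt _ _).2 hn))⟩
  · rintro ⟨r, hr, hm⟩
    refine ⟨φ r, (h.lt _ _).2 hr, fun n hn => ?_⟩
    obtain ⟨s, rfl⟩ := h.2 a n hn.le
    exact (h.1 _ _).2 (hm _ ((h.lt _ _).1 hn))

/-- Remove a nonzero element which is not a sum of two other nonzero elements. -/
def removeAtom (E : AddSubmonoid ℕ) (d : ℕ) (hd : 0 < d)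
    (h : ∀ a ∈ E, ∀ b ∈ E, a + b = d → a = d ∨ b = d) : AddSubmonoid ℕ where
  carrier := {n | n ∈ E ∧ n ≠ d}
  zero_mem' := ⟨E.zero_mem, by omega⟩
  add_mem' := by
    rintro a b ⟨ha, ha'⟩ ⟨hb, hb'⟩
    refine ⟨E.add_mem ha hb, fun hab => ?_⟩
    rcases h a ha b hb hab with h | h
    · exact ha' h
    · exact hb' h

theorem removeAtom_lt (E : AddSubmonoid ℕ) (d : ℕ) (hd : 0 < d)
    (h : ∀ a ∈ E, ∀ b ∈ E, a + b = d → a = d ∨ b = d) (hdE : d ∈ E) :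
    removeAtom E d hd h < E := by
  refine lt_iff_le_not_ge.2 ⟨fun n hn => hn.1, fun hle => ?_⟩
  exact (hle hdE).2 rfl

theorem mem_multiples_nat (d n : ℕ) : n ∈ AddSubmonoid.multiples d ↔ d ∣ n := by
  rw [AddSubmonoid.mem_multiples_iff]
  constructor
  · rintro ⟨k, rfl⟩; exact ⟨k, by simp [mul_comm]⟩
  · rintro ⟨k, rfl⟩; exact ⟨k, by simp [mul_comm]⟩

theorem local_multiples (d : ℕ) (hd : 0 < d) : LocalAt (AddSubmonoid.multiples d) := by
  have h : ∀ a ∈ AddSubmonoid.multiples d, ∀ b ∈ AddSubmonoid.multiples d,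
      a + b = d → a = d ∨ b = d := by
    intro a ha b hb hab
    rw [mem_multiples_nat] at ha hb
    rcases Nat.eq_zero_or_pos a with h0 | h0
    · right; omega
    · left; have := Nat.le_of_dvd h0 ha; omega
  refine ⟨removeAtom _ d hd h, removeAtom_lt _ d hd h ((mem_multiples_nat _ _).2 dvd_rfl), ?_⟩
  intro n hn x hx
  refine ⟨hn.le hx, ?_⟩
  rintro rfl
  exact hn.not_ge ((AddSubmonoid.multiples_le).2 hx)

theorem eq_multiples_of_local (E : AddSubmonoid ℕ) (hE : LocalAt E) :
    ∃ d, 0 < d ∧ E = AddSubmonoid.multiples d := by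
  classical
  obtain ⟨R, hR, hm⟩ := hE
  have hex : ∃ d, 0 < d ∧ d ∈ E := by
    by_contra hc
    push Not at hc
    refine hR.not_ge fun n hn => ?_
    rcases Nat.eq_zero_or_pos n with h | h
    · rw [h]; exact R.zero_mem
    · exact absurd hn (hc n h)
  have hd := Nat.find_spec hex
  have hmin : ∀ m, m ∈ E → 0 < m → Nat.find hex ≤ m := fun m h h' => Nat.find_min' hex ⟨h', h⟩
  generalize Nat.find hex = d at hd hmin
  refine ⟨d, hd.1, ?_⟩
  by_contra hne
  have hex2 : ∃ e, e ∈ E ∧ ¬ d ∣ e := by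
    by_contra hc
    push Not at hc
    refine hne (le_antisymm (fun n hn => (mem_multiples_nat _ _).2 (hc n hn)) ?_)
    exact (AddSubmonoid.multiples_le).2 hd.2
  have he := Nat.find_spec hex2
  have hmin2 : ∀ m, m ∈ E → m < Nat.find hex2 → d ∣ m := fun m h h' => by
    by_contra hc
    exact Nat.find_min hex2 h' ⟨h, hc⟩
  generalize Nat.find hex2 = e at he hmin2
  have hde : d ≠ e := by rintro rfl; exact he.2 dvd_rfl
  have he0 : 0 < e := Nat.pos_of_ne_zero (by rintro rfl; exact he.2 (dvd_zero _))
  have h1 : ∀ a ∈ E, ∀ b ∈ E, a + b = d → a = d ∨ b = d := by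
    intro a ha b hb hab
    rcases Nat.eq_zero_or_pos a with h0 | h0
    · right; omega
    · left; have := hmin a ha h0; omega
  have h2 : ∀ a ∈ E, ∀ b ∈ E, a + b = e → a = e ∨ b = e := by
    intro a ha b hb hab
    by_contra hc
    push Not at hc
    refine he.2 ?_
    rw [← hab]
    exact dvd_add (hmin2 a ha (by omega)) (hmin2 b hb (by omega))
  have k1 := hm _ (removeAtom_lt E d hd.1 h1 hd.2)
  have k2 := hm _ (removeAtom_lt E e he0 h2 he.1)
  refine hR.not_ge fun n hn => ?_
  by_cases hnd : n = d
  · exact k2 ⟨hn, by omega⟩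
  · exact k1 ⟨hn, hnd⟩

section abstractK
variable {K : Type*} [CommMonoid K] {φ : Submonoid K → AddSubmonoid ℕ}

theorem LowEmb.finite_eq_bot (h : LowEmb φ) (M : Submonoid K) (hM : (M : Set K).Finite) :
    M = ⊥ := by
  by_contra hne
  have hex : ∃ d, 0 < d ∧ d ∈ φ M := by
    by_contra hc
    push Not at hc
    refine hne (le_bot_iff.1 ((h.1 _ _).1 fun n hn => ?_))
    rcases Nat.eq_zero_or_pos n with h | h
    · rw [h]; exact AddSubmonoid.zero_mem _
    · exact absurd hn (hc n h)
  obtain ⟨d, hd, hdM⟩ := hex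
  have hN : ∀ k : ℕ, AddSubmonoid.multiples (k * d) ≤ φ M := fun k =>
    (AddSubmonoid.multiples_le).2 (by simpa using AddSubmonoid.nsmul_mem _ hdM k)
  choose N hNe using fun k => h.2 M _ (hN k)
  have hNM : ∀ k, N k ≤ M := fun k => (h.1 _ _).1 (by rw [hNe]; exact hN k)
  have hinj : Function.Injective (fun k => (N k : Set K)) := by
    intro i j hij
    have : N i = N j := SetLike.coe_injective hij
    have h1 : AddSubmonoid.multiples (i * d) = AddSubmonoid.multiples (j * d) := by
      rw [← hNe, ← hNe, this]
    have h2 : j * d ∣ i * d := by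
      rw [← mem_multiples_nat, ← h1, mem_multiples_nat]
    have h3 : i * d ∣ j * d := by
      rw [← mem_multiples_nat, h1, mem_multiples_nat]
    exact Nat.eq_of_mul_eq_mul_right hd (Nat.dvd_antisymm h3 h2)
  have hfin : (Set.range (fun k => (N k : Set K))).Finite := by
    refine hM.finite_subsets.subset ?_
    rintro _ ⟨k, rfl⟩
    exact hNM k
  exact Set.infinite_range_of_injective hinj hfin

theorem LowEmb.pow_inj (h : LowEmb φ) {x : K} (hx : x ≠ 1) :
    Function.Injective (fun n : ℕ => x ^ n) := by
  by_contra hc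
  have hex : ∃ i j, i < j ∧ x ^ i = x ^ j := by
    simp only [Function.Injective] at hc
    push Not at hc
    obtain ⟨i, j, hij, hne⟩ := hc
    rcases lt_or_gt_of_ne hne with h | h
    · exact ⟨i, j, h, hij⟩
    · exact ⟨j, i, h, hij.symm⟩
  obtain ⟨i, j, hij, he⟩ := hex
  have hall : ∀ n, ∃ m < j, x ^ m = x ^ n := by
    intro n
    induction n using Nat.strong_induction_on with
    | _ n ih =>
      by_cases hn : n < j
      · exact ⟨n, hn, rfl⟩
      · obtain ⟨m, hm, hme⟩ := ih (i + (n - j)) (by omega)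
        refine ⟨m, hm, ?_⟩
        rw [hme, pow_add, he, ← pow_add]
        congr 1; omega
  have hfin : (Submonoid.powers x : Set K).Finite := by
    refine ((Set.finite_lt_nat j).image (fun n => x ^ n)).subset ?_
    rintro _ ⟨n, rfl⟩
    obtain ⟨m, hm, hme⟩ := hall n
    exact ⟨m, hm, hme⟩
  have := h.finite_eq_bot _ hfin
  exact hx (Submonoid.mem_bot.1 (this ▸ Submonoid.mem_powers x))

/-- The submonoid of `x`-powers with exponent in `T`. -/
def powSub (x : K) (T : AddSubmonoid ℕ) : Submonoid K where
  carrier := {z | ∃ n ∈ T, x ^ n = z}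
  one_mem' := ⟨0, T.zero_mem, pow_zero x⟩
  mul_mem' := by
    rintro _ _ ⟨n, hn, rfl⟩ ⟨m, hm, rfl⟩
    exact ⟨n + m, T.add_mem hn hm, pow_add x n m⟩

/-- The exponents `n` with `x ^ n ∈ N`. -/
def expSub (x : K) (N : Submonoid K) : AddSubmonoid ℕ where
  carrier := {n | x ^ n ∈ N}
  zero_mem' := by simp
  add_mem' := by
    intro a b ha hb
    simp only [Set.mem_setOf_eq] at *
    rw [pow_add]; exact N.mul_mem ha hb

theorem powSub_expSub (x : K) (N : Submonoid K) (h : N ≤ Submonoid.powers x) :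
    powSub x (expSub x N) = N := by
  ext z
  constructor
  · rintro ⟨n, hn, rfl⟩; exact hn
  · intro hz
    obtain ⟨n, rfl⟩ := h hz
    exact ⟨n, hz, rfl⟩

theorem powSub_top (x : K) : powSub x ⊤ = Submonoid.powers x := by
  ext z
  constructor
  · rintro ⟨n, hn, rfl⟩; exact ⟨n, rfl⟩
  · rintro ⟨n, rfl⟩; exact ⟨n, trivial, rfl⟩

theorem lowEmb_powSub {x : K} (hx : Function.Injective (fun n : ℕ => x ^ n)) :
    LowEmb (powSub x) := by
  refine ⟨fun S T => ⟨fun h n hn => ?_, fun h => ?_⟩, fun T e he => ⟨expSub x e, ?_⟩⟩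
  · obtain ⟨m, hm, hmn⟩ := h (show x ^ n ∈ powSub x S from ⟨n, hn, rfl⟩)
    rw [← hx hmn]; exact hm
  · rintro _ ⟨n, hn, rfl⟩
    exact ⟨n, h hn, rfl⟩
  · refine powSub_expSub x e (he.trans ?_)
    rintro _ ⟨n, hn, rfl⟩
    exact ⟨n, rfl⟩

theorem LowEmb.powers_eq (h : LowEmb φ) {x : K} (hx : x ≠ 1) :
    ∃ d, 0 < d ∧ φ (Submonoid.powers x) = AddSubmonoid.multiples d := by
  have h2 := lowEmb_powSub (h.pow_inj hx)
  apply eq_multiples_of_local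
  rw [h.local_iff, ← powSub_top, h2.local_iff]
  have : (⊤ : AddSubmonoid ℕ) = AddSubmonoid.multiples 1 := by
    ext n; simp [mem_multiples_nat]
  rw [this]
  exact local_multiples 1 one_pos

theorem LowEmb.key (h : LowEmb φ) {b c : K} (hb : b ≠ 1) (hc : c ≠ 1) :
    ∃ t, 0 < t ∧ ∀ n, b ^ n ∈ Submonoid.powers c ↔ t ∣ n := by
  obtain ⟨d, hd, hdb⟩ := h.powers_eq hb
  obtain ⟨e, he, hec⟩ := h.powers_eq hc
  have h2 := lowEmb_powSub (h.pow_inj hb)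
  set l := Nat.lcm d e with hl
  have hl0 : 0 < l := Nat.lcm_pos hd he
  obtain ⟨N, hN⟩ := h.2 (Submonoid.powers b) (AddSubmonoid.multiples l) (by
    rw [hdb]
    exact AddSubmonoid.multiples_le.2 ((mem_multiples_nat _ _).2 (Nat.dvd_lcm_left d e)))
  have hNb : N ≤ Submonoid.powers b := by
    rw [← h.1, hN, hdb]
    exact AddSubmonoid.multiples_le.2 ((mem_multiples_nat _ _).2 (Nat.dvd_lcm_left d e))
  have hNc : N ≤ Submonoid.powers c := by
    rw [← h.1, hN, hec]
    exact AddSubmonoid.multiples_le.2 ((mem_multiples_nat _ _).2 (Nat.dvd_lcm_right d e))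
  have hge : Submonoid.powers b ⊓ Submonoid.powers c ≤ N := by
    rw [← h.1, hN]
    intro n hn
    have h3 := (h.1 _ _).2 (inf_le_left : Submonoid.powers b ⊓ Submonoid.powers c ≤ _) hn
    have h4 := (h.1 _ _).2 (inf_le_right : Submonoid.powers b ⊓ Submonoid.powers c ≤ _) hn
    rw [hdb, mem_multiples_nat] at h3
    rw [hec, mem_multiples_nat] at h4
    exact (mem_multiples_nat _ _).2 (Nat.lcm_dvd h3 h4)
  have hloc : LocalAt (expSub b N) := by
    rw [← h2.local_iff, powSub_expSub b N hNb, ← h.local_iff, hN]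
    exact local_multiples l hl0
  obtain ⟨t, ht, hte⟩ := eq_multiples_of_local _ hloc
  refine ⟨t, ht, fun n => ?_⟩
  rw [← mem_multiples_nat, ← hte]
  exact ⟨fun hn => hge ⟨⟨n, rfl⟩, hn⟩, fun hn => hNc hn⟩

theorem LowEmb.cancel_one (h : LowEmb φ) {a c : K} (hac : a = a * c) : c = 1 := by
  by_contra hc
  have ha : a ≠ 1 := by rintro rfl; exact hc (by simpa using hac.symm)
  obtain ⟨t, ht, hk⟩ := h.key ha hc
  obtain ⟨l, hl⟩ := (hk t).2 dvd_rfl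
  simp only at hl
  have h1 : a ^ t = a ^ t * c := by
    obtain ⟨s, rfl⟩ : ∃ s, t = s + 1 := ⟨t - 1, by omega⟩
    rw [pow_succ, mul_assoc, ← hac]
  rw [← hl, ← pow_succ] at h1
  have := h.pow_inj hc h1
  omega

theorem LowEmb.cancel (h : LowEmb φ) {a b c : K} (habc : a * b = a * c) : b = c := by
  by_cases ha : a = 1
  · simpa [ha] using habc
  by_cases hb : b = 1
  · subst hb
    exact (h.cancel_one (by simpa using habc)).symm
  by_cases hc : c = 1
  · subst hc
    exact (h.cancel_one (by simpa using habc.symm))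
  obtain ⟨u, hu, hk⟩ := h.key ha hb
  obtain ⟨l, hl⟩ := (hk u).2 dvd_rfl
  simp only at hl
  have h1 : b ^ l * b = b ^ l * c := by
    obtain ⟨s, rfl⟩ : ∃ s, u = s + 1 := ⟨u - 1, by omega⟩
    rw [hl, pow_succ, mul_assoc, habc, mul_assoc]
  have h2 : ∀ i, b ^ l * b ^ i = b ^ l * c ^ i := by
    intro i
    induction i with
    | zero => simp
    | succ i ih =>
      rw [pow_succ, ← mul_assoc, ih, mul_right_comm, h1, mul_right_comm, mul_assoc, ← pow_succ]
  obtain ⟨t, ht, hk⟩ := h.key hb hc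
  obtain ⟨s, hs⟩ := (hk t).2 dvd_rfl
  simp only at hs
  have h3 := h2 s
  rw [hs, ← pow_add, ← pow_add] at h3
  have h4 : l + s = l + t := h.pow_inj hb h3
  have h5 : s = t := by omega
  subst h5
  have h6 : c ^ (s * l + 1) = b ^ (s * l + 1) := by
    obtain ⟨r, hr⟩ : ∃ r, s * l = r + l := ⟨s * l - l, by
      have : l ≤ s * l := Nat.le_mul_of_pos_left l ht
      omega⟩
    rw [pow_succ, pow_mul, hs, ← pow_mul, pow_succ, hr, pow_add, mul_assoc, ← h1, mul_assoc]
  have h7 : s ∣ s * l + 1 := (hk _).1 ⟨_, h6⟩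
  have h8 : s ∣ 1 := (Nat.dvd_add_right (dvd_mul_right s l)).1 h7
  have h9 : s = 1 := Nat.dvd_one.1 h8
  subst h9
  simpa using hs.symm
end abstractK

theorem lowEmb_map_subtype (H : AddSubmonoid ℕ) :
    LowEmb (fun E : AddSubmonoid H => E.map H.subtype) := by
  refine ⟨fun a b => ?_, fun a e he => ⟨e.comap H.subtype, ?_⟩⟩
  · exact AddSubmonoid.map_le_map_iff_of_injective Subtype.val_injective
  · ext n
    constructor
    · rintro ⟨m, hm, rfl⟩; exact hm
    · intro hn
      obtain ⟨m, hm, rfl⟩ := he hn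
      exact ⟨m, hn, rfl⟩

theorem exists_lowEmb (H : AddSubmonoid ℕ)
    {K : Type*} [CommMonoid K]
    (f : {X : Set H // X.Nonempty} → {Y : Set K // Y.Nonempty})
    (hbij : Function.Bijective f) (hmul : ∀ A B, f (A + B) = f A * f B) :
    ∃ φ : Submonoid K → AddSubmonoid H, LowEmb φ := by
  obtain ⟨g, hgf, hfg⟩ := Function.bijective_iff_has_inverse.1 hbij
  have gmul : ∀ A B, g (A * B) = g A + g B := by
    intro A B
    apply hbij.1
    rw [hmul, hfg, hfg, hfg]
  -- units
  have f0 : f ⟨{0}, Set.singleton_nonempty 0⟩ = ⟨{1}, Set.singleton_nonempty 1⟩ := by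
    have h1 : (⟨{0}, Set.singleton_nonempty 0⟩ : {X : Set H // X.Nonempty}) +
        g ⟨{1}, Set.singleton_nonempty 1⟩ = g ⟨{1}, Set.singleton_nonempty 1⟩ := by
      apply Subtype.ext
      change ({0} : Set H) + _ = _
      simp
    have h2 := congrArg f h1
    rw [hmul, hfg] at h2
    rw [← h2]
    apply Subtype.ext
    change _ = (_ : Set K) * ({1} : Set K)
    simp
  have hred : ∀ u v : K, u * v = 1 → u = 1 := by
    intro u v huv
    have h1 : (⟨{u}, Set.singleton_nonempty u⟩ : {X : Set K // X.Nonempty}) *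
        ⟨{v}, Set.singleton_nonempty v⟩ = ⟨{1}, Set.singleton_nonempty 1⟩ := by
      apply Subtype.ext
      change ({u} : Set K) * ({v} : Set K) = {1}
      simp [huv]
    have h2 := congrArg g h1
    rw [gmul, ← f0, hgf] at h2
    have h3 : (g ⟨{u}, Set.singleton_nonempty u⟩).1 + (g ⟨{v}, Set.singleton_nonempty v⟩).1
      = ({0} : Set H) := congrArg Subtype.val h2
    have h4 : g ⟨{u}, Set.singleton_nonempty u⟩ = ⟨{0}, Set.singleton_nonempty 0⟩ := by
      apply Subtype.ext
      refine (Set.Nonempty.subset_singleton_iff (g _).2).1 ?_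
      intro a ha
      obtain ⟨b, hb⟩ := (g ⟨{v}, Set.singleton_nonempty v⟩).2
      have h5 : a + b ∈ ({0} : Set H) := h3 ▸ Set.add_mem_add ha hb
      have h6 : (a : ℕ) + b = 0 := congrArg Subtype.val (Set.mem_singleton_iff.1 h5)
      exact Set.mem_singleton_iff.2 (Subtype.ext (by change (a : ℕ) = 0; omega))
    have h5 := congrArg f h4
    rw [f0, hfg] at h5
    have h6 : ({u} : Set K) = {1} := congrArg Subtype.val h5
    simpa using h6
  have hidem : ∀ A : Set H, A.Nonempty → A + A = A → (0 : H) ∈ A := by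
    intro A hA hAA
    classical
    have hex : ∃ n : ℕ, ∃ a ∈ A, (a : ℕ) = n := by
      obtain ⟨a, ha⟩ := hA
      exact ⟨a, a, ha, rfl⟩
    obtain ⟨a, ha, han⟩ := Nat.find_spec hex
    have hmin : ∀ b ∈ A, (a : ℕ) ≤ b := fun b hb => by
      rw [han]; exact Nat.find_min' hex ⟨b, hb, rfl⟩
    rw [← hAA] at ha
    obtain ⟨b, hb, c, hc, hbc⟩ := Set.mem_add.1 ha
    have h1 := hmin b hb
    have h2 := hmin c hc
    have h3 : (b : ℕ) + c = a := congrArg Subtype.val hbc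
    have : b = 0 := Subtype.ext (by change (b : ℕ) = 0; omega)
    rwa [← this]
  let s : Submonoid K → {X : Set K // X.Nonempty} := fun M => ⟨M, ⟨1, M.one_mem⟩⟩
  have hss : ∀ M N, s M * s N = s N ↔ M ≤ N := by
    intro M N
    constructor
    · intro h a ha
      have h1 : (M : Set K) * (N : Set K) = N := congrArg Subtype.val h
      have h2 : a * 1 ∈ (N : Set K) := h1 ▸ Set.mul_mem_mul ha N.one_mem
      simpa using h2
    · intro h
      apply Subtype.ext
      change (M : Set K) * (N : Set K) = N
      apply Set.Subset.antisymm
      · rintro _ ⟨a, ha, b, hb, rfl⟩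
        exact N.mul_mem (h ha) hb
      · intro b hb
        exact ⟨1, M.one_mem, b, hb, one_mul b⟩
  have hgi : ∀ M, (g (s M)).1 + (g (s M)).1 = (g (s M)).1 := by
    intro M
    have := congrArg g ((hss M M).2 le_rfl)
    rw [gmul] at this
    exact congrArg Subtype.val this
  let φ : Submonoid K → AddSubmonoid H := fun M =>
    { carrier := (g (s M)).1
      zero_mem' := hidem _ (g (s M)).2 (hgi M)
      add_mem' := fun {a b} ha hb => by
        have : a + b ∈ (g (s M)).1 + (g (s M)).1 := Set.add_mem_add ha hb
        rwa [hgi M] at this }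
  have hadd : ∀ E F : AddSubmonoid H, (E : Set H) + (F : Set H) = F ↔ E ≤ F := by
    intro E F
    constructor
    · intro h a ha
      have h2 : a + 0 ∈ (F : Set H) := h ▸ Set.add_mem_add ha F.zero_mem
      simpa using h2
    · intro h
      apply Set.Subset.antisymm
      · rintro _ ⟨a, ha, b, hb, rfl⟩
        exact F.add_mem (h ha) hb
      · intro b hb
        exact ⟨0, E.zero_mem, b, hb, zero_add b⟩
  refine ⟨φ, fun M N => ?_, fun M E hE => ?_⟩
  · rw [← hss, ← hadd]
    constructor
    · intro h
      have h1 : g (s M) + g (s N) = g (s N) := Subtype.ext h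
      have h2 := congrArg f h1
      rwa [hmul, hfg, hfg] at h2
    · intro h
      have h1 := congrArg g h
      rw [gmul] at h1
      exact congrArg Subtype.val h1
  · let e : {X : Set H // X.Nonempty} := ⟨E, ⟨0, E.zero_mem⟩⟩
    have h1 : e + g (s M) = g (s M) := Subtype.ext ((hadd E (φ M)).2 hE)
    have h2 := congrArg f h1
    rw [hmul, hfg] at h2
    have h3 : (f e).1 * (M : Set K) = M := congrArg Subtype.val h2
    have h4 : (1 : K) ∈ (f e).1 := by
      have h5 : (1 : K) ∈ (f e).1 * (M : Set K) := by rw [h3]; exact M.one_mem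
      obtain ⟨u, hu, v, hv, huv⟩ := Set.mem_mul.1 h5
      rwa [← hred u v huv]
    have h5 : e + e = e := Subtype.ext ((hadd E E).2 le_rfl)
    have h6 := congrArg f h5
    rw [hmul] at h6
    have h7 : (f e).1 * (f e).1 = (f e).1 := congrArg Subtype.val h6
    let N : Submonoid K :=
      { carrier := (f e).1
        one_mem' := h4
        mul_mem' := fun {a b} ha hb => by
          have : a * b ∈ (f e).1 * (f e).1 := Set.mul_mem_mul ha hb
          rwa [h7] at this }
    refine ⟨N, ?_⟩
    have h8 : s N = f e := Subtype.ext rfl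
    apply SetLike.coe_injective
    change (g (s N)).1 = (E : Set H)
    rw [h8, hgf]

theorem stmt_18 (H : AddSubmonoid ℕ) (hH : ((H : Set ℕ)ᶜ).Finite)
    {K : Type*} [CommMonoid K]
    (f : {X : Set H // X.Nonempty} → {Y : Set K // Y.Nonempty})
    (hbij : Function.Bijective f) (hmul : ∀ A B, f (A + B) = f A * f B) :
    (∀ x y : K, x ≠ y → x * x ≠ x * y) ∧
      (∀ a b c : K, a * b = a * c → b = c) := by
  obtain ⟨φ, hφ⟩ := exists_lowEmb H f hbij hmul
  have h := hφ.comp (lowEmb_map_subtype H)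
  exact ⟨fun x y hxy hc => hxy (h.cancel hc), fun a b c habc => h.cancel habc⟩
end

section
/- If a numerical monoid H is globally isomorphic to a semigroup K (i.e., P(H) ≅ P(K)), then K is isomorphic to H; in particular, the class of numerical monoids is globally closed. -/
open Pointwise

theorem cancK {K : Type*} [CommSemigroup K] (A : Set K) (hne : A.Nonempty)
    (hc : ∀ X Y : Set K, X.Nonempty → Y.Nonempty → A * X = A * Y → X = Y) :
    ∃ a, A = {a} := by
  have key : ∀ x ∈ A, ∀ y ∈ A, ∀ z ∈ A, x * x = y * z → z = x := by
    intro x hx y hy z hz h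
    by_contra hzx
    have h1 : A * A = A * (A \ {x}) := by
      apply Set.Subset.antisymm
      · rintro _ ⟨p, hp, q, hq, rfl⟩
        by_cases hqx : q = x
        · subst hqx
          by_cases hpq : p = q
          · subst hpq
            exact ⟨y, hy, z, ⟨hz, hzx⟩, h.symm⟩
          · exact ⟨q, hx, p, ⟨hp, hpq⟩, mul_comm _ _⟩
        · exact ⟨p, hp, q, ⟨hq, hqx⟩, rfl⟩
      · exact Set.mul_subset_mul_left Set.sdiff_subset
    have h2 := hc A (A \ {x}) hne ⟨z, hz, hzx⟩ h1
    rw [h2] at hx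
    exact hx.2 rfl
  obtain ⟨a, ha⟩ := hne
  refine ⟨a, ?_⟩
  by_contra hA
  have : ∃ b ∈ A, b ≠ a := by
    by_contra! hcon
    exact hA (Set.eq_singleton_iff_unique_mem.2 ⟨ha, hcon⟩)
  obtain ⟨b, hb, hba⟩ := this
  have haa : a * a ≠ a * b := fun h => hba (key a ha a ha b hb h)
  have h1 : A * (A * A) = A * ((A * A) \ {a * b}) := by
    apply Set.Subset.antisymm
    · rintro _ ⟨p, hp, s, ⟨q, hq, r, hr, rfl⟩, rfl⟩
      by_cases hqr : q * r = a * b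
      · by_cases h1 : p * b = a * b
        · by_cases h2 : p * a = a * b
          · refine ⟨b, hb, p * p, ⟨⟨p, hp, p, hp, rfl⟩, ?_⟩, ?_⟩
            · intro h3
              have e1 := key p hp a ha b hb h3
              have e2 := key p hp b hb a ha (by rw [mul_comm b a]; exact h3)
              exact hba (e1.trans e2.symm)
            · change b * (p * p) = p * (q * r)
              rw [hqr, ← h1, mul_comm b, mul_assoc]
          · refine ⟨b, hb, p * a, ⟨⟨p, hp, a, ha, rfl⟩, h2⟩, ?_⟩
            change b * (p * a) = p * (q * r)
            rw [hqr, mul_comm b, mul_assoc]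
        · refine ⟨a, ha, p * b, ⟨⟨p, hp, b, hb, rfl⟩, h1⟩, ?_⟩
          change a * (p * b) = p * (q * r)
          rw [hqr, mul_left_comm]
      · exact ⟨p, hp, q * r, ⟨⟨q, hq, r, hr, rfl⟩, hqr⟩, rfl⟩
    · exact Set.mul_subset_mul_left Set.sdiff_subset
  have h2 := hc (A * A) ((A * A) \ {a * b}) ⟨a * a, a, ha, a, ha, rfl⟩ ⟨a * a, ⟨a, ha, a, ha, rfl⟩, haa⟩ h1
  have h3 : a * b ∈ A * A := ⟨a, ha, b, hb, rfl⟩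
  rw [h2] at h3
  exact h3.2 rfl

theorem cancH (H : AddSubmonoid ℕ) (hH : ((H : Set ℕ)ᶜ).Finite) (A : Set H) (hne : A.Nonempty)
    (hc : ∀ X Y : Set H, X.Nonempty → Y.Nonempty → A + X = A + Y → X = Y) :
    ∃ a, A = {a} := by
  obtain ⟨c, hcc⟩ : ∃ c, ∀ n, c ≤ n → n ∈ H := by
    obtain ⟨c, hb⟩ := hH.bddAbove
    refine ⟨c + 1, fun n hn => ?_⟩
    by_contra h
    have := hb (show n ∈ ((H : Set ℕ)ᶜ) from h)
    omega
  have key : ∀ a ∈ A, ∀ b ∈ A, ¬ (a : ℕ) < b := by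
    intro a ha b hb hab
    let x : H := ⟨c + b, hcc _ (by omega)⟩
    have hy : (⟨c + a, hcc _ (by omega)⟩ : H) ≠ x := by
      intro h
      have : c + (a : ℕ) = c + b := congrArg Subtype.val h
      omega
    have h1 : A + Set.univ = A + (Set.univ \ {x}) := by
      apply Set.Subset.antisymm
      · rintro _ ⟨p, hp, q, -, rfl⟩
        by_cases hq : q = x
        · subst hq
          by_cases hpa : p = a
          · subst hpa
            refine ⟨b, hb, ⟨c + p, hcc _ (by omega)⟩, ⟨trivial, hy⟩, ?_⟩
            apply Subtype.ext
            change (b : ℕ) + (c + p) = p + (c + b)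
            omega
          · refine ⟨a, ha, ⟨p + (c + b) - a, hcc _ (by omega)⟩, ⟨trivial, ?_⟩, ?_⟩
            · intro h
              have : (p : ℕ) + (c + b) - a = c + b := congrArg Subtype.val h
              exact hpa (Subtype.ext (by omega))
            · apply Subtype.ext
              change (a : ℕ) + (p + (c + b) - a) = p + (c + b)
              omega
        · exact ⟨p, hp, q, ⟨trivial, hq⟩, rfl⟩
      · exact Set.add_subset_add_left Set.sdiff_subset
    have h2 := hc Set.univ (Set.univ \ {x}) ⟨x, trivial⟩ ⟨_, trivial, hy⟩ h1
    have h3 : x ∈ (Set.univ : Set H) := trivial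
    rw [h2] at h3
    exact h3.2 rfl
  obtain ⟨a, ha⟩ := hne
  refine ⟨a, Set.eq_singleton_iff_unique_mem.2 ⟨ha, fun b hb => Subtype.ext ?_⟩⟩
  have := key a ha b hb
  have := key b hb a ha
  omega

/-- An idempotent of the power monoid of `H` contains zero and is closed under addition. -/
theorem idemH (H : AddSubmonoid ℕ) (M : Set H) (hne : M.Nonempty) (h : M + M = M) :
    (0 : H) ∈ M ∧ ∀ a ∈ M, ∀ b ∈ M, a + b ∈ M := by
  refine ⟨?_, fun a ha b hb => h ▸ Set.add_mem_add ha hb⟩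
  by_contra h0
  have : ∀ n : ℕ, ∀ m : H, m ∈ M → (m : ℕ) = n → False := by
    intro n
    induction n using Nat.strong_induction_on with
    | _ n ih =>
      intro m hm hmn
      rw [← h] at hm
      obtain ⟨p, hp, q, hq, hpq⟩ := hm
      have e : (p : ℕ) + q = m := congrArg Subtype.val hpq
      have hq0 : (q : ℕ) ≠ 0 := fun hz => h0 (by
        have : q = 0 := Subtype.ext hz
        exact this ▸ hq)
      exact ih p (by omega) p hp rfl
  obtain ⟨m, hm⟩ := hne
  exact this _ m hm rfl

theorem auxMain (H : AddSubmonoid ℕ) (hH : ((H : Set ℕ)ᶜ).Finite)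
    {K : Type*} [CommMonoid K]
    (f : {X : Set H // X.Nonempty} → {Y : Set K // Y.Nonempty})
    (hbij : Function.Bijective f) (hmul : ∀ A B, f (A + B) = f A * f B)
    (hone : (f ⟨{0}, 0, rfl⟩).1 = {1}) :
    ∃ e : H ≃ K, ∀ a b : H, e (a + b) = e a * e b := by
  have hsing : ∀ h : H, ∃ k : K, (f ⟨{h}, h, rfl⟩).1 = {k} := by
    intro h
    apply cancK _ (f ⟨{h}, h, rfl⟩).2
    intro X Y hX hY hXY
    obtain ⟨⟨X', hX'⟩, eX⟩ := hbij.2 ⟨X, hX⟩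
    obtain ⟨⟨Y', hY'⟩, eY⟩ := hbij.2 ⟨Y, hY⟩
    have h1 : f (⟨{h}, h, rfl⟩ + ⟨X', hX'⟩) = f (⟨{h}, h, rfl⟩ + ⟨Y', hY'⟩) := by
      rw [hmul, hmul, eX, eY]
      exact Subtype.ext hXY
    have h2 : ({h} : Set H) + X' = {h} + Y' := congrArg Subtype.val (hbij.1 h1)
    have h3 : X' = Y' := by
      rw [Set.singleton_add, Set.singleton_add] at h2
      exact (Set.image_injective.2 (add_right_injective h)) h2
    subst h3
    exact congrArg Subtype.val (eX.symm.trans eY)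
  choose e he using hsing
  have hadd : ∀ a b, e (a + b) = e a * e b := by
    intro a b
    have h1 : f ⟨{a + b}, _, rfl⟩ = f ⟨{a}, a, rfl⟩ * f ⟨{b}, b, rfl⟩ := by
      rw [← hmul]
      congr 1
      apply Subtype.ext
      exact (Set.singleton_add_singleton).symm
    have h2 : (f ⟨{a + b}, _, rfl⟩).1 = (f ⟨{a}, a, rfl⟩).1 * (f ⟨{b}, b, rfl⟩).1 :=
      congrArg Subtype.val h1
    rw [he, he, he, Set.singleton_mul_singleton] at h2
    exact Set.singleton_injective h2
  have hinj : Function.Injective e := by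
    intro a b hab
    have h1 : f ⟨{a}, a, rfl⟩ = f ⟨{b}, b, rfl⟩ := Subtype.ext (by rw [he, he, hab])
    exact Set.singleton_injective (congrArg Subtype.val (hbij.1 h1))
  have he0 : e 0 = 1 := Set.singleton_injective ((he 0).symm.trans hone)
  -- the elements `e h` are cancellative
  have hcan : ∀ h x y, e h * x = e h * y → x = y := by
    intro h x y hxy
    obtain ⟨⟨X', hX'⟩, eX⟩ := hbij.2 ⟨{x}, x, rfl⟩
    obtain ⟨⟨Y', hY'⟩, eY⟩ := hbij.2 ⟨{y}, y, rfl⟩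
    have h1 : f (⟨{h}, h, rfl⟩ + ⟨X', hX'⟩) = f (⟨{h}, h, rfl⟩ + ⟨Y', hY'⟩) := by
      rw [hmul, hmul, eX, eY]
      apply Subtype.ext
      change (f ⟨{h}, h, rfl⟩).1 * {x} = (f ⟨{h}, h, rfl⟩).1 * {y}
      rw [he, Set.singleton_mul_singleton, Set.singleton_mul_singleton, hxy]
    have h2 : ({h} : Set H) + X' = {h} + Y' := congrArg Subtype.val (hbij.1 h1)
    have h3 : X' = Y' := by
      rw [Set.singleton_add, Set.singleton_add] at h2
      exact (Set.image_injective.2 (add_right_injective h)) h2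
    subst h3
    exact Set.singleton_injective (congrArg Subtype.val (eX.symm.trans eY))
  -- submonoids of `K` and their preimages
  have hsub : ∀ S : Submonoid K, S ≠ ⊥ → ∃ M : {X : Set H // X.Nonempty}, (f M).1 = S ∧
      (0 : H) ∈ M.1 ∧ (∀ a ∈ M.1, ∀ b ∈ M.1, a + b ∈ M.1) ∧ ∃ m ∈ M.1, m ≠ 0 := by
    intro S hS
    obtain ⟨M, eM⟩ := hbij.2 ⟨(S : Set K), 1, S.one_mem⟩
    have hMM : M + M = M := by
      apply hbij.1
      rw [hmul, eM]
      exact Subtype.ext S.coe_mul_self_eq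
    obtain ⟨h0, hcl⟩ := idemH H M.1 M.2 (congrArg Subtype.val hMM)
    refine ⟨M, by rw [eM], h0, hcl, ?_⟩
    by_contra! hcon
    apply hS
    have h1 : M = ⟨{0}, 0, rfl⟩ := Subtype.ext (Set.eq_singleton_iff_unique_mem.2 ⟨h0, hcon⟩)
    apply SetLike.coe_injective
    have h2 : (f M).1 = S := by rw [eM]
    rw [← h2, h1, hone]
    rfl
  have hmeet : ∀ S T : Submonoid K, S ≠ ⊥ → T ≠ ⊥ → ∃ g ∈ S, g ∈ T ∧ g ≠ 1 := by
    intro S T hS hT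
    obtain ⟨M, eM, M0, Mcl, m, hm, hm0⟩ := hsub S hS
    obtain ⟨N, eN, N0, Ncl, n, hn, hn0⟩ := hsub T hT
    let J : {X : Set H // X.Nonempty} := ⟨M.1 ∩ N.1, 0, M0, N0⟩
    have absorb : ∀ M : {X : Set H // X.Nonempty}, ∀ S : Submonoid K, (f M).1 = S →
        J.1 ⊆ M.1 → (∀ a ∈ M.1, ∀ b ∈ M.1, a + b ∈ M.1) → (f J).1 ⊆ S := by
      intro M S eM hJ Mcl g hg
      have h1 : J + M = M := by
        apply Subtype.ext
        apply Set.Subset.antisymm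
        · rintro _ ⟨p, hp, q, hq, rfl⟩
          exact Mcl p (hJ hp) q hq
        · intro q hq
          exact ⟨0, ⟨M0, N0⟩, q, hq, zero_add q⟩
      have h2 : (f J).1 * (f M).1 = (f M).1 := by
        have := hmul J M
        rw [h1] at this
        exact (congrArg Subtype.val this).symm
      rw [eM] at h2
      rw [← h2]
      exact ⟨g, hg, 1, S.one_mem, mul_one g⟩
    have hJS := absorb M S eM Set.inter_subset_left Mcl
    have hJT := absorb N T eN Set.inter_subset_right Ncl
    by_contra! hcon
    have h1 : f J = f ⟨{0}, 0, rfl⟩ := by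
      apply Subtype.ext
      rw [hone]
      exact (f J).2.subset_singleton_iff.1 (fun g hg => hcon g (hJS hg) (hJT hg))
    have h2 : J.1 = {0} := congrArg Subtype.val (hbij.1 h1)
    have hmul' : ∀ M : Set H, (0 : H) ∈ M → (∀ a ∈ M, ∀ b ∈ M, a + b ∈ M) →
        ∀ a ∈ M, ∀ t : ℕ, t • a ∈ M := by
      intro M h0 hcl a ha t
      induction t with
      | zero => simpa using h0
      | succ t ih => rw [succ_nsmul]; exact hcl _ ih _ ha
    have e1 : (n : ℕ) • m = (m : ℕ) • n := by
      apply Subtype.ext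
      simp [mul_comm]
    have h3 : (n : ℕ) • m ∈ J.1 :=
      ⟨hmul' _ M0 Mcl m hm _, e1 ▸ hmul' _ N0 Ncl n hn _⟩
    rw [h2] at h3
    have h4 : (n : ℕ) * (m : ℕ) = 0 := by
      have := congrArg Subtype.val (Set.mem_singleton_iff.1 h3)
      simpa using this
    rcases Nat.mul_eq_zero.1 h4 with h | h
    · exact hn0 (Subtype.ext h)
    · exact hm0 (Subtype.ext h)
  obtain ⟨u, hu0⟩ : ∃ u : H, u ≠ 0 := by
    obtain ⟨c, hb⟩ := hH.bddAbove
    have hc : c + 1 ∈ H := by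
      by_contra h
      have := hb (show c + 1 ∈ ((H : Set ℕ)ᶜ) from h)
      omega
    exact ⟨⟨c + 1, hc⟩, fun h => by simpa using congrArg Subtype.val h⟩
  have hpow : ∀ t : ℕ, ∀ h, e h ^ t = e (t • h) := by
    intro t h
    induction t with
    | zero => simp [he0]
    | succ t ih => rw [pow_succ, ih, succ_nsmul, hadd]
  have hbot : ∀ k : K, k ≠ 1 → Submonoid.powers k ≠ ⊥ := by
    intro k hk h
    have h1 := Submonoid.mem_powers k
    rw [h, Submonoid.mem_bot] at h1
    exact hk h1
  have hKcan : ∀ k x y : K, k * x = k * y → x = y := by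
    intro k x y hxy
    by_cases hk : k = 1
    · simpa [hk] using hxy
    obtain ⟨g, hg1, hg2, hg⟩ := hmeet (Submonoid.powers k) (Submonoid.powers (e u))
      (hbot k hk)
      (hbot (e u) (fun h => hu0 (hinj (h.trans he0.symm))))
    obtain ⟨a, rfl⟩ := hg1
    obtain ⟨b, hb⟩ := hg2
    cases a with
    | zero => simp at hg
    | succ a =>
      apply hcan (b • u)
      have hb' : e u ^ b = k ^ (a + 1) := hb
      rw [← hpow, hb', pow_succ, mul_assoc, hxy, mul_assoc]
  have hsurj : Function.Surjective e := by
    intro k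
    obtain ⟨B, eB⟩ := hbij.2 ⟨{k}, k, rfl⟩
    obtain ⟨h, hB⟩ := cancH H hH B.1 B.2 (by
      intro X Y hX hY hXY
      have h1 : f (B + ⟨X, hX⟩) = f (B + ⟨Y, hY⟩) := congrArg f (Subtype.ext hXY)
      rw [hmul, hmul, eB] at h1
      have h2 : ({k} : Set K) * (f ⟨X, hX⟩).1 = {k} * (f ⟨Y, hY⟩).1 := congrArg Subtype.val h1
      rw [Set.singleton_mul, Set.singleton_mul] at h2
      have h3 := (Set.image_injective.2 (fun x y => hKcan k x y)) h2
      exact congrArg Subtype.val (hbij.1 (Subtype.ext h3)))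
    refine ⟨h, ?_⟩
    have h1 : B = ⟨{h}, h, rfl⟩ := Subtype.ext hB
    have h2 := he h
    rw [← h1, eB] at h2
    exact (Set.singleton_injective h2).symm
  exact ⟨Equiv.ofBijective e ⟨hinj, hsurj⟩, hadd⟩

theorem stmt_19 (H : AddSubmonoid ℕ) (hH : ((H : Set ℕ)ᶜ).Finite)
    {K : Type*} [Semigroup K]
    (f : {X : Set H // X.Nonempty} → {Y : Set K // Y.Nonempty})
    (hbij : Function.Bijective f) (hmul : ∀ A B, f (A + B) = f A * f B) :
    ∃ e : H ≃ K, ∀ a b : H, e (a + b) = e a * e b := by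
  have hcomm : ∀ a b : K, a * b = b * a := by
    intro a b
    obtain ⟨X, eX⟩ := hbij.2 ⟨{a}, a, rfl⟩
    obtain ⟨Y, eY⟩ := hbij.2 ⟨{b}, b, rfl⟩
    have h1 : X + Y = Y + X := Subtype.ext (add_comm X.1 Y.1)
    have h2 : f X * f Y = f Y * f X := by rw [← hmul, ← hmul, h1]
    rw [eX, eY] at h2
    have h3 : ({a} : Set K) * {b} = {b} * {a} := congrArg Subtype.val h2
    rw [Set.singleton_mul_singleton, Set.singleton_mul_singleton] at h3
    exact Set.singleton_injective h3
  have hid : ∀ i ∈ (f ⟨{0}, 0, rfl⟩).1, ∀ k : K, i * k = k := by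
    intro i hi k
    obtain ⟨X, eX⟩ := hbij.2 ⟨{k}, k, rfl⟩
    have h1 : (⟨{0}, 0, rfl⟩ : {X : Set H // X.Nonempty}) + X = X := by
      apply Subtype.ext
      change ({0} : Set H) + X.1 = X.1
      simp
    have h2 := hmul ⟨{0}, 0, rfl⟩ X
    rw [h1, eX] at h2
    have h3 : ({k} : Set K) = (f ⟨{0}, 0, rfl⟩).1 * {k} := congrArg Subtype.val h2
    have h4 : i * k ∈ (f ⟨{0}, 0, rfl⟩).1 * ({k} : Set K) := Set.mul_mem_mul hi rfl
    rw [← h3] at h4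
    exact h4
  obtain ⟨i, hi⟩ := (f ⟨{0}, 0, rfl⟩).2
  letI : CommMonoid K :=
    { ‹Semigroup K› with
      one := i
      one_mul := hid i hi
      mul_one := fun k => (hcomm k i).trans (hid i hi k)
      mul_comm := hcomm }
  refine auxMain H hH f hbij hmul ?_
  refine Set.eq_singleton_iff_unique_mem.2 ⟨hi, fun j hj => ?_⟩
  exact ((hid i hi j).symm.trans (hcomm i j)).trans (hid j hj i)
end
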